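/- arXiv:1708.02430 — 2 statements merged into one kernel-verified Lean document; each statement's English description precedes it below -/
import Mathlib

section
/- Let M ∈ ℝ^{4n×4n} be a JRS-symmetric matrix that is also symmetric (Mᵀ = M). Then there exists an orthogonally JRS-symplectic matrix W ∈ ℝ^{4n×4n} such that W M Wᵀ = H₀ ⊕ H₀ ⊕ H₀ ⊕ H₀, where H₀ ∈ ℝ^{n×n} is a symmetric tridiagonal matrix. -/
open Matrix Quaternion
open scoped Kronecker Quaternion

noncomputable section

/-- The 4×4 coefficient matrix of `J`. -/
def Jb : Matrix (Fin 4) (Fin 4) ℝ := !![0,0,-1,0; 0,0,0,-1; 1,0,0,0; 0,1,0,0]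
/-- The 4×4 coefficient matrix of `R`. -/
def Rb : Matrix (Fin 4) (Fin 4) ℝ := !![0,-1,0,0; 1,0,0,0; 0,0,0,1; 0,0,-1,0]
/-- The 4×4 coefficient matrix of `S`. -/
def Sb : Matrix (Fin 4) (Fin 4) ℝ := !![0,0,0,-1; 0,0,1,0; 0,-1,0,0; 1,0,0,0]

/-- `J_n = [[0,0,−I_n,0],[0,0,0,−I_n],[I_n,0,0,0],[0,I_n,0,0]]`. -/
def JJ (n : ℕ) : Matrix (Fin 4 × Fin n) (Fin 4 × Fin n) ℝ :=
  Jb ⊗ₖ (1 : Matrix (Fin n) (Fin n) ℝ)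
/-- `R_n = [[0,−I_n,0,0],[I_n,0,0,0],[0,0,0,I_n],[0,0,−I_n,0]]`. -/
def RRm (n : ℕ) : Matrix (Fin 4 × Fin n) (Fin 4 × Fin n) ℝ :=
  Rb ⊗ₖ (1 : Matrix (Fin n) (Fin n) ℝ)
/-- `S_n = [[0,0,0,−I_n],[0,0,I_n,0],[0,−I_n,0,0],[I_n,0,0,0]]`. -/
def SSm (n : ℕ) : Matrix (Fin 4 × Fin n) (Fin 4 × Fin n) ℝ :=
  Sb ⊗ₖ (1 : Matrix (Fin n) (Fin n) ℝ)

/-- A real 4m×4n matrix `M` is JRS-symmetric if `J_m M J_nᵀ = M`,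
`R_m M R_nᵀ = M` and `S_m M S_nᵀ = M`. -/
def JRSSymmetric {m n : ℕ} (M : Matrix (Fin 4 × Fin m) (Fin 4 × Fin n) ℝ) : Prop :=
  JJ m * M * (JJ n)ᵀ = M ∧ RRm m * M * (RRm n)ᵀ = M ∧ SSm m * M * (SSm n)ᵀ = M

/-- A real 4m×4n matrix `O` is JRS-symplectic if `O J_n Oᵀ = J_m`,
`O R_n Oᵀ = R_m` and `O S_n Oᵀ = S_m`. -/
def JRSSymplectic {m n : ℕ} (O : Matrix (Fin 4 × Fin m) (Fin 4 × Fin n) ℝ) : Prop :=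
  O * JJ n * Oᵀ = JJ m ∧ O * RRm n * Oᵀ = RRm m ∧ O * SSm n * Oᵀ = SSm m

/-- A real 4n×4n matrix is orthogonally JRS-symplectic if it is orthogonal
and JRS-symplectic. -/
def OrthoJRSSymplectic {n : ℕ} (W : Matrix (Fin 4 × Fin n) (Fin 4 × Fin n) ℝ) : Prop :=
  Wᵀ * W = 1 ∧ JRSSymplectic W

/-- The 4m×4n block matrix
`[[Q₀,Q₂,Q₁,Q₃],[−Q₂,Q₀,Q₃,−Q₁],[−Q₁,−Q₃,Q₀,Q₂],[−Q₃,Q₁,−Q₂,Q₀]]`. -/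
def upsilonBlocks {m n : ℕ} (Q0 Q1 Q2 Q3 : Matrix (Fin m) (Fin n) ℝ) :
    Matrix (Fin 4 × Fin m) (Fin 4 × Fin n) ℝ := fun p q =>
  !![Q0 p.2 q.2, Q2 p.2 q.2, Q1 p.2 q.2, Q3 p.2 q.2;
     -(Q2 p.2 q.2), Q0 p.2 q.2, Q3 p.2 q.2, -(Q1 p.2 q.2);
     -(Q1 p.2 q.2), -(Q3 p.2 q.2), Q0 p.2 q.2, Q2 p.2 q.2;
     -(Q3 p.2 q.2), Q1 p.2 q.2, -(Q2 p.2 q.2), Q0 p.2 q.2] p.1 q.1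

/-- The real counterpart `Υ_Q` of a quaternion matrix `Q`. -/
def Upsilon {m n : ℕ} (Q : Matrix (Fin m) (Fin n) ℍ[ℝ]) :
    Matrix (Fin 4 × Fin m) (Fin 4 × Fin n) ℝ :=
  upsilonBlocks (fun i j => (Q i j).re) (fun i j => (Q i j).imI)
    (fun i j => (Q i j).imJ) (fun i j => (Q i j).imK)

/-- Upper Hessenberg: zero below the first subdiagonal. -/
def UpperHessenbergM {n : ℕ} (A : Matrix (Fin n) (Fin n) ℝ) : Prop :=
  ∀ i j : Fin n, (j : ℕ) + 1 < (i : ℕ) → A i j = 0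

/-- Upper triangular: zero below the diagonal. -/
def UpperTriangularM {m n : ℕ} (A : Matrix (Fin m) (Fin n) ℝ) : Prop :=
  ∀ (i : Fin m) (j : Fin n), (j : ℕ) < (i : ℕ) → A i j = 0

/-- Strictly upper triangular: zero on and below the diagonal. -/
def StrictlyUpperTriangularM {m n : ℕ} (A : Matrix (Fin m) (Fin n) ℝ) : Prop :=
  ∀ (i : Fin m) (j : Fin n), (j : ℕ) ≤ (i : ℕ) → A i j = 0

/-- Tridiagonal: zero outside the three central diagonals. -/
def TridiagonalM {n : ℕ} (A : Matrix (Fin n) (Fin n) ℝ) : Prop :=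
  ∀ i j : Fin n, ((i : ℕ) + 1 < (j : ℕ) ∨ (j : ℕ) + 1 < (i : ℕ)) → A i j = 0

/-- Quaternion units acting on the left. -/
def Eb : Fin 4 → Matrix (Fin 4) (Fin 4) ℝ := ![1, Rb, Jb, Sb]

/-- Quaternion units at size `4n`. -/
def Fb (n : ℕ) (a : Fin 4) : Matrix (Fin 4 × Fin n) (Fin 4 × Fin n) ℝ :=
  Eb a ⊗ₖ (1 : Matrix (Fin n) (Fin n) ℝ)

/-- Integer version of the quaternion units. -/
def EZ : Fin 4 → Fin 4 → Fin 4 → ℤ :=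
  ![![![1,0,0,0], ![0,1,0,0], ![0,0,1,0], ![0,0,0,1]],
    ![![0,-1,0,0], ![1,0,0,0], ![0,0,0,1], ![0,0,-1,0]],
    ![![0,0,-1,0], ![0,0,0,-1], ![1,0,0,0], ![0,1,0,0]],
    ![![0,0,0,-1], ![0,0,1,0], ![0,-1,0,0], ![1,0,0,0]]]

lemma Eb_cast (a i j : Fin 4) : Eb a i j = (EZ a i j : ℝ) := by
  fin_cases a <;> fin_cases i <;> fin_cases j <;>
    simp [Eb, EZ, Jb, Rb, Sb]

lemma EZ_tmul : ∀ a b i j : Fin 4, ∑ k, EZ a k i * EZ b k j =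
    ∑ c, (∑ k, EZ a k c * EZ b k 0) * EZ c i j := by
  decide +kernel

lemma EZ_add : ∀ a b i j : Fin 4, ∑ k, EZ a k i * EZ b k j + ∑ k, EZ b k i * EZ a k j =
    (if a = b then 2 else 0) * (if i = j then 1 else 0) := by
  decide +kernel

lemma EZ_mul : ∀ a b i j : Fin 4, ∑ k, EZ a i k * EZ b k j = ∑ c, EZ a c b * EZ c i j := by
  decide +kernel

lemma Eb_tmul (a b : Fin 4) :
    (Eb a)ᵀ * Eb b = ∑ c, ((Eb a)ᵀ * Eb b) c 0 • Eb c := by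
  ext i j
  simp only [Matrix.mul_apply, Matrix.sum_apply, Matrix.smul_apply, Matrix.transpose_apply,
    smul_eq_mul, Eb_cast]
  exact_mod_cast EZ_tmul a b i j

lemma Eb_add (a b : Fin 4) :
    (Eb a)ᵀ * Eb b + (Eb b)ᵀ * Eb a = (if a = b then (2 : ℝ) else 0) • 1 := by
  ext i j
  simp only [Matrix.mul_apply, Matrix.add_apply, Matrix.smul_apply, Matrix.transpose_apply,
    smul_eq_mul, Eb_cast, Matrix.one_apply]
  exact_mod_cast EZ_add a b i j

lemma Eb_mul (a b : Fin 4) : Eb a * Eb b = ∑ c, Eb a c b • Eb c := by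
  ext i j
  simp only [Matrix.mul_apply, Matrix.sum_apply, Matrix.smul_apply, smul_eq_mul, Eb_cast]
  exact_mod_cast EZ_mul a b i j

lemma Jb_mul (b : Fin 4) : Jb * Eb b = ∑ c, Jb c b • Eb c := Eb_mul 2 b

lemma Rb_mul (b : Fin 4) : Rb * Eb b = ∑ c, Rb c b • Eb c := Eb_mul 1 b

lemma Sb_mul (b : Fin 4) : Sb * Eb b = ∑ c, Sb c b • Eb c := Eb_mul 3 b

lemma sum_kron {n : ℕ} (f : Fin 4 → ℝ) :
    (∑ c, f c • Eb c) ⊗ₖ (1 : Matrix (Fin n) (Fin n) ℝ) = ∑ c, f c • Fb n c := by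
  ext p q
  simp [Fb, Matrix.sum_apply, Finset.sum_mul, mul_assoc]

lemma Fb_tmul (n : ℕ) (a b : Fin 4) :
    (Fb n a)ᵀ * Fb n b = ∑ c, ((Eb a)ᵀ * Eb b) c 0 • Fb n c := by
  rw [← sum_kron, ← Eb_tmul, Fb, Fb, ← Matrix.kroneckerMap_transpose, ← Matrix.mul_kronecker_mul]
  simp

lemma Fb_add (n : ℕ) (a b : Fin 4) :
    (Fb n a)ᵀ * Fb n b + (Fb n b)ᵀ * Fb n a = (if a = b then (2 : ℝ) else 0) • 1 := by
  rw [Fb, Fb, ← Matrix.kroneckerMap_transpose, ← Matrix.kroneckerMap_transpose,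
    ← Matrix.mul_kronecker_mul, ← Matrix.mul_kronecker_mul]
  simp only [Matrix.transpose_one, mul_one]
  rw [← Matrix.add_kronecker, Eb_add, Matrix.smul_kronecker, Matrix.one_kronecker_one]

lemma Fb_self (n : ℕ) (a : Fin 4) : (Fb n a)ᵀ * Fb n a = 1 := by
  have h := Fb_add n a a
  simp only [if_true, ← two_smul ℝ ((Fb n a)ᵀ * Fb n a)] at h
  exact smul_right_injective _ (two_ne_zero) h

lemma comm_of_conj {ι : Type*} [Fintype ι] [DecidableEq ι] (F M : Matrix ι ι ℝ)
    (hF : Fᵀ * F = 1) (h : F * M * Fᵀ = M) : M * F = F * M := by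
  conv_lhs => rw [← h]
  rw [mul_assoc, hF, mul_one]

lemma Fb_comm {n : ℕ} (M : Matrix (Fin 4 × Fin n) (Fin 4 × Fin n) ℝ)
    (hM : JRSSymmetric M) (a : Fin 4) : M * Fb n a = Fb n a * M := by
  obtain ⟨h1, h2, h3⟩ := hM
  apply comm_of_conj _ _ (Fb_self n a)
  fin_cases a
  · simp [Fb, Eb]
  · exact h2
  · exact h1
  · exact h3

lemma Fb_dot {n : ℕ} (a b : Fin 4) (x y : Fin 4 × Fin n → ℝ) :
    (Fb n a *ᵥ x) ⬝ᵥ (Fb n b *ᵥ y) = x ⬝ᵥ (((Fb n a)ᵀ * Fb n b) *ᵥ y) := by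
  rw [← Matrix.mulVec_mulVec, Matrix.dotProduct_mulVec, Matrix.dotProduct_mulVec,
    Matrix.vecMul_transpose, Matrix.dotProduct_mulVec]

lemma Fb_dot_self {n : ℕ} (a b : Fin 4) (x : Fin 4 × Fin n → ℝ) :
    (Fb n a *ᵥ x) ⬝ᵥ (Fb n b *ᵥ x) = if a = b then x ⬝ᵥ x else 0 := by
  have h : (Fb n a *ᵥ x) ⬝ᵥ (Fb n b *ᵥ x) + (Fb n b *ᵥ x) ⬝ᵥ (Fb n a *ᵥ x)
      = (if a = b then (2 : ℝ) else 0) * (x ⬝ᵥ x) := by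
    rw [Fb_dot, Fb_dot, ← dotProduct_add, ← Matrix.add_mulVec, Fb_add, Matrix.smul_mulVec,
      Matrix.one_mulVec, dotProduct_smul, smul_eq_mul]
  rw [dotProduct_comm (Fb n b *ᵥ x)] at h
  split_ifs at h ⊢ <;> linarith

lemma Fb_dot_zero {n : ℕ} (x z : Fin 4 × Fin n → ℝ)
    (h : ∀ c, z ⬝ᵥ (Fb n c *ᵥ x) = 0) (a b : Fin 4) :
    (Fb n a *ᵥ z) ⬝ᵥ (Fb n b *ᵥ x) = 0 := by
  rw [Fb_dot, Fb_tmul, Matrix.sum_mulVec, dotProduct_sum]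
  apply Finset.sum_eq_zero
  intro c _
  rw [Matrix.smul_mulVec, dotProduct_smul, h, smul_zero]

/-- The eigenvector step. -/
lemma exists_new {n k : ℕ} (hk : k < n) (M : Matrix (Fin 4 × Fin n) (Fin 4 × Fin n) ℝ)
    (hsym : Mᵀ = M) (u : Fin 4 × Fin k → (Fin 4 × Fin n → ℝ)) (l : Fin 4 × Fin k → ℝ)
    (hu : ∀ p q, u p ⬝ᵥ u q = if p = q then 1 else 0)
    (hl : ∀ p, M *ᵥ u p = l p • u p) :
    ∃ (z : Fin 4 × Fin n → ℝ) (t : ℝ), z ⬝ᵥ z = 1 ∧ M *ᵥ z = t • z ∧ ∀ p, z ⬝ᵥ u p = 0 := by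
  have hH : M.IsHermitian := by
    rw [Matrix.IsHermitian, Matrix.conjTranspose_eq_transpose_of_trivial, hsym]
  obtain ⟨y, t, hy, hyU⟩ : ∃ (y : Fin 4 × Fin n → ℝ) (t : ℝ), M *ᵥ y = t • y ∧
      y ∉ Submodule.span ℝ (Set.range u) := by
    by_contra! hcon
    let v : Fin 4 × Fin n → (Fin 4 × Fin n → ℝ) := fun p => WithLp.ofLp (hH.eigenvectorBasis p)
    have hv : ∀ p, v p ∈ Submodule.span ℝ (Set.range u) := fun p =>
      hcon _ (hH.eigenvalues p) (hH.mulVec_eigenvectorBasis p)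
    have hli : LinearIndependent ℝ v := by
      have := hH.eigenvectorBasis.toBasis.linearIndependent
      have := this.map' (WithLp.linearEquiv 2 ℝ (Fin 4 × Fin n → ℝ)).toLinearMap
        (LinearEquiv.ker _)
      have hv' : v = (WithLp.linearEquiv 2 ℝ (Fin 4 × Fin n → ℝ)).toLinearMap ∘
          hH.eigenvectorBasis.toBasis := by
        ext p q
        simp [v]
      rw [hv']
      exact this
    have h1 := finrank_span_eq_card hli
    have h2 : Module.finrank ℝ (Submodule.span ℝ (Set.range v)) ≤
        Module.finrank ℝ (Submodule.span ℝ (Set.range u)) :=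
      Submodule.finrank_mono (Submodule.span_le.2 (by rintro _ ⟨p, rfl⟩; exact hv p))
    have h3 := finrank_range_le_card (R := ℝ) u
    rw [Set.finrank] at h3
    simp at h1 h3
    omega
  let w : Fin 4 × Fin n → ℝ := y - ∑ p, (y ⬝ᵥ u p) • u p
  have hw0 : w ≠ 0 := by
    intro h
    apply hyU
    rw [sub_eq_zero.1 h]
    exact Submodule.sum_mem _ fun p _ => Submodule.smul_mem _ _ (Submodule.subset_span ⟨p, rfl⟩)
  have hwu : ∀ p, w ⬝ᵥ u p = 0 := by
    intro p
    simp [w, sub_dotProduct, sum_dotProduct, hu]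
  have hMw : M *ᵥ w = t • w := by
    have key : ∀ p, (y ⬝ᵥ u p) • l p • u p = t • (y ⬝ᵥ u p) • u p := by
      intro p
      have : (M *ᵥ y) ⬝ᵥ u p = y ⬝ᵥ (M *ᵥ u p) := by
        rw [Matrix.dotProduct_mulVec, ← Matrix.mulVec_transpose, hsym]
      rw [hy, hl, smul_dotProduct, dotProduct_smul, smul_eq_mul, smul_eq_mul] at this
      rw [smul_smul, smul_smul, this, mul_comm]
    simp only [w, Matrix.mulVec_sub, Matrix.mulVec_sum, Matrix.mulVec_smul, hy, hl, key,
      smul_sub, Finset.smul_sum]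
  have hpos : 0 < w ⬝ᵥ w := by
    have h1 : 0 ≤ w ⬝ᵥ w := Finset.sum_nonneg fun i _ => mul_self_nonneg _
    exact lt_of_le_of_ne h1 (fun h => hw0 (dotProduct_self_eq_zero.1 h.symm))
  refine ⟨(Real.sqrt (w ⬝ᵥ w))⁻¹ • w, t, ?_, ?_, ?_⟩
  · have hs := Real.mul_self_sqrt hpos.le
    have hs0 := (Real.sqrt_pos.2 hpos).ne'
    rw [smul_dotProduct, dotProduct_smul, smul_eq_mul, smul_eq_mul]
    generalize Real.sqrt (w ⬝ᵥ w) = s at *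
    rw [← hs]
    field_simp
  · rw [Matrix.mulVec_smul, hMw, smul_comm]
  · intro p
    rw [smul_dotProduct, hwu, smul_zero]

lemma exists_frame {n : ℕ} (M : Matrix (Fin 4 × Fin n) (Fin 4 × Fin n) ℝ)
    (hM : JRSSymmetric M) (hsym : Mᵀ = M) (k : ℕ) (hk : k ≤ n) :
    ∃ (x : Fin k → (Fin 4 × Fin n → ℝ)) (l : Fin k → ℝ),
      (∀ i, M *ᵥ x i = l i • x i) ∧
      ∀ a b i j, (Fb n a *ᵥ x i) ⬝ᵥ (Fb n b *ᵥ x j) = if a = b ∧ i = j then 1 else 0 := by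
  induction k with
  | zero => exact ⟨fun i => i.elim0, fun i => i.elim0, fun i => i.elim0, fun _ _ i => i.elim0⟩
  | succ k ih =>
    obtain ⟨x, l, hx, ho⟩ := ih (by omega)
    obtain ⟨z, t, hz1, hz2, hz3⟩ := exists_new (k := k) (by omega) M hsym
      (fun p => Fb n p.1 *ᵥ x p.2) (fun p => l p.2)
      (by rintro ⟨a, i⟩ ⟨b, j⟩; simp [ho])
      (by
        rintro ⟨a, i⟩
        simp only
        rw [Matrix.mulVec_mulVec, Fb_comm M hM, ← Matrix.mulVec_mulVec, hx, Matrix.mulVec_smul])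
    have hzx : ∀ a b i, (Fb n a *ᵥ z) ⬝ᵥ (Fb n b *ᵥ x i) = 0 := fun a b i =>
      Fb_dot_zero (x i) z (fun c => hz3 (c, i)) a b
    refine ⟨Fin.cons z x, Fin.cons t l, ?_, ?_⟩
    · intro i
      refine Fin.cases ?_ (fun i => ?_) i
      · simpa using hz2
      · simpa using hx i
    · intro a b i j
      refine Fin.cases ?_ (fun i => ?_) i <;> refine Fin.cases ?_ (fun j => ?_) j
      · simp [Fb_dot_self, hz1]
      · simp [hzx, (Fin.succ_ne_zero j).symm]
      · rw [dotProduct_comm]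
        simp [hzx]
      · simp [ho]

lemma frame_entry {n : ℕ} (x : Fin n → (Fin 4 × Fin n → ℝ))
    (A : Matrix (Fin 4 × Fin n) (Fin 4 × Fin n) ℝ) (a b : Fin 4) (i j : Fin n) :
    ((Matrix.of fun p : Fin 4 × Fin n => Fb n p.1 *ᵥ x p.2) * A *
      (Matrix.of fun p : Fin 4 × Fin n => Fb n p.1 *ᵥ x p.2)ᵀ) (a, i) (b, j) =
      (Fb n a *ᵥ x i) ⬝ᵥ (A *ᵥ (Fb n b *ᵥ x j)) := by
  rw [mul_assoc]
  rfl

lemma frame_unit {n : ℕ} (x : Fin n → (Fin 4 × Fin n → ℝ))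
    (ho : ∀ a b i j, (Fb n a *ᵥ x i) ⬝ᵥ (Fb n b *ᵥ x j) = if a = b ∧ i = j then 1 else 0)
    (B : Matrix (Fin 4) (Fin 4) ℝ) (hB : ∀ b, B * Eb b = ∑ c, B c b • Eb c) :
    (Matrix.of fun p : Fin 4 × Fin n => Fb n p.1 *ᵥ x p.2) * (B ⊗ₖ 1) *
      (Matrix.of fun p : Fin 4 × Fin n => Fb n p.1 *ᵥ x p.2)ᵀ = B ⊗ₖ 1 := by
  ext ⟨a, i⟩ ⟨b, j⟩
  have h : (B ⊗ₖ (1 : Matrix (Fin n) (Fin n) ℝ)) * Fb n b = ∑ c, B c b • Fb n c := by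
    rw [← sum_kron, ← hB, Fb, ← Matrix.mul_kronecker_mul, mul_one]
  rw [frame_entry, Matrix.mulVec_mulVec, h, Matrix.sum_mulVec, dotProduct_sum]
  simp only [Matrix.smul_mulVec, dotProduct_smul, ho, Matrix.kroneckerMap_apply,
    Matrix.one_apply, smul_eq_mul]
  by_cases hij : i = j <;> simp [hij]

/-- A symmetric JRS-symmetric matrix is orthogonally
JRS-symplectically similar to `H₀ ⊕ H₀ ⊕ H₀ ⊕ H₀` with `H₀` symmetric
tridiagonal. -/
theorem jrs_symmetric_tridiagonalization {n : ℕ}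
    (M : Matrix (Fin 4 × Fin n) (Fin 4 × Fin n) ℝ)
    (hM : JRSSymmetric M) (hsym : Mᵀ = M) :
    ∃ (W : Matrix (Fin 4 × Fin n) (Fin 4 × Fin n) ℝ)
      (H0 : Matrix (Fin n) (Fin n) ℝ),
      OrthoJRSSymplectic W ∧
      W * M * Wᵀ = (1 : Matrix (Fin 4) (Fin 4) ℝ) ⊗ₖ H0 ∧
      H0ᵀ = H0 ∧ TridiagonalM H0 := by
  obtain ⟨x, l, hx, ho⟩ := exists_frame M hM hsym n le_rfl
  refine ⟨Matrix.of fun p : Fin 4 × Fin n => Fb n p.1 *ᵥ x p.2, Matrix.diagonal l,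
    ⟨?_, frame_unit x ho Jb Jb_mul, frame_unit x ho Rb Rb_mul, frame_unit x ho Sb Sb_mul⟩,
    ?_, Matrix.diagonal_transpose l, ?_⟩
  · rw [mul_eq_one_comm]
    ext ⟨a, i⟩ ⟨b, j⟩
    have h := frame_entry x 1 a b i j
    rw [mul_one] at h
    rw [h, Matrix.one_mulVec, ho]
    simp [Matrix.one_apply]
  · ext ⟨a, i⟩ ⟨b, j⟩
    rw [frame_entry, Matrix.mulVec_mulVec, Fb_comm M hM, ← Matrix.mulVec_mulVec, hx,
      Matrix.mulVec_smul, dotProduct_smul, ho]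
    by_cases hij : i = j <;> simp [hij, Matrix.one_apply]
  · intro i j h
    apply Matrix.diagonal_apply_ne
    rintro rfl
    omega
end
end

section
/- Let M ∈ ℝ^{4n×4n} be a JRS-symmetric matrix that is also skew-symmetric (Mᵀ = −M). Then there exists an orthogonally JRS-symplectic matrix W ∈ ℝ^{4n×4n} such that W M Wᵀ = H has the block partitioning H = [[H₀,H₂,H₁,H₃],[−H₂,H₀,H₃,−H₁],[−H₁,−H₃,H₀,H₂],[−H₃,H₁,−H₂,H₀]], where H₀ ∈ ℝ^{n×n} is skew-symmetric and tridiagonal, and H₁, H₂, H₃ ∈ ℝ^{n×n} are diagonal. -/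
open Matrix Quaternion
open scoped Kronecker Quaternion

noncomputable section

theorem aux_eig {E : Type*} [NormedAddCommGroup E] [InnerProductSpace ℝ E] [FiniteDimensional ℝ E]
    (A : E →ₗ[ℝ] E) (hA : A.IsSymmetric) (K : Submodule ℝ E) (hK : K ≠ ⊥)
    (hinv : ∀ x ∈ K, A x ∈ K) : ∃ w ∈ K, ∃ c : ℝ, inner ℝ w w = 1 ∧ A w = c • w := by
  have hs := hA.restrict_invariant hinv
  have : Nontrivial K := Submodule.nontrivial_iff_ne_bot.mpr hK
  have h1 := hs.hasEigenvalue_iSup_of_finiteDimensional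
  obtain ⟨u, hu⟩ := h1.exists_hasEigenvector
  set c : ℝ := _
  have hu1 : A u = c • (u : E) := congrArg Subtype.val hu.apply_eq_smul
  have hu0 : (u : E) ≠ 0 := fun h => hu.2 (Subtype.ext h)
  have hn : ‖(u : E)‖ ≠ 0 := norm_ne_zero_iff.mpr hu0
  refine ⟨(‖(u : E)‖)⁻¹ • (u : E), K.smul_mem _ u.2, c, ?_, ?_⟩
  · rw [inner_smul_left, inner_smul_right, real_inner_self_eq_norm_sq]
    simp; field_simp
  · rw [map_smul, hu1, smul_comm]

theorem aux_family {E : Type*} [NormedAddCommGroup E] [InnerProductSpace ℝ E]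
    [FiniteDimensional ℝ E] (J R M : E →ₗ[ℝ] E)
    (hJ : ∀ x y, inner ℝ x (J y) = - inner ℝ (J x) y)
    (hR : ∀ x y, inner ℝ x (R y) = - inner ℝ (R x) y)
    (hM : ∀ x y, inner ℝ x (M y) = - inner ℝ (M x) y)
    (hJJ : ∀ x, J (J x) = -x) (hRR : ∀ x, R (R x) = -x)
    (hRJ : ∀ x, R (J x) = - J (R x))
    (hMJ : ∀ x, M (J x) = J (M x)) (hMR : ∀ x, M (R x) = R (M x)) (k : ℕ)
    (hk : 4 * k ≤ Module.finrank ℝ E) :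
    ∃ (v : Fin k → E) (c : Fin k → ℝ),
      (∀ i j, inner ℝ (v i) (v j) = if i = j then 1 else 0) ∧
      (∀ i j, inner ℝ (v i) (R (v j)) = 0) ∧
      (∀ i j, inner ℝ (v i) (J (v j)) = 0) ∧
      (∀ i j, inner ℝ (v i) (J (R (v j))) = 0) ∧
      (∀ i, M (v i) = c i • J (v i)) := by
  induction k with
  | zero => exact ⟨Fin.elim0, Fin.elim0, fun i => i.elim0, fun i => i.elim0, fun i => i.elim0,
      fun i => i.elim0, fun i => i.elim0⟩
  | succ k ih =>
    obtain ⟨v, c, h1, h2, h3, h4, h5⟩ := ih (by omega)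
    let T : Fin 4 → (E →ₗ[ℝ] E) := ![LinearMap.id, R, J, J ∘ₗ R]
    let L : E →ₗ[ℝ] (Fin 4 × Fin k → ℝ) :=
      LinearMap.pi fun p => (innerₗ E (v p.2)) ∘ₗ T p.1
    have hL : LinearMap.ker L ≠ ⊥ := by
      apply LinearMap.ker_ne_bot_of_finrank_lt
      simp
      omega
    have memL : ∀ x, x ∈ LinearMap.ker L ↔ ∀ i, inner ℝ (v i) x = 0 ∧ inner ℝ (v i) (R x) = 0 ∧
        inner ℝ (v i) (J x) = 0 ∧ inner ℝ (v i) (J (R x)) = 0 := by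
      intro x
      rw [LinearMap.mem_ker, funext_iff]
      constructor
      · intro h i
        exact ⟨h (0, i), h (1, i), h (2, i), h (3, i)⟩
      · rintro h ⟨a, i⟩
        obtain ⟨ha, hb, hc, hd⟩ := h i
        fin_cases a
        · exact ha
        · exact hb
        · exact hc
        · exact hd
    have key : ∀ x i, inner ℝ (v i) (M x) = c i * inner ℝ (v i) (J x) := by
      intro x i
      rw [hM, h5, inner_smul_left, hJ]
      simp
    obtain ⟨w, hwK, d, hw1, hw2⟩ := aux_eig (J ∘ₗ M) (by
        intro x y
        simp only [LinearMap.comp_apply]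
        rw [hJ, hM, hMJ]; simp) _ hL (by
        intro x hx
        rw [memL] at hx ⊢
        intro i
        obtain ⟨ha, hb, hc, hd⟩ := hx i
        simp only [LinearMap.comp_apply, hJJ, hRJ, ← hMR, ← hMJ, key, inner_neg_right, map_neg]
        simp [ha, hb, hc, hd])
    have hMw : M w = (-d) • J w := by
      have := congrArg J hw2
      simp only [LinearMap.comp_apply, hJJ, map_smul] at this
      rw [neg_smul, ← this, neg_neg]
    rw [memL] at hwK
    have e1 : inner ℝ w (R w) = 0 := by
      have := hR w w
      rw [real_inner_comm] at this
      have := real_inner_comm w (R w)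
      linarith
    have e2 : inner ℝ w (J w) = 0 := by
      have := hJ w w
      have := real_inner_comm w (J w)
      linarith
    have e3 : inner ℝ w (J (R w)) = 0 := by
      have a1 := hJ w (R w)
      have a2 := hR (J w) w
      have a3 := real_inner_comm w (J (R w))
      rw [hRJ, inner_neg_left] at a2
      linarith
    have s1 : ∀ i, inner ℝ w (v i) = 0 := fun i => by
      rw [real_inner_comm]; exact (hwK i).1
    have s2 : ∀ i, inner ℝ w (R (v i)) = 0 := fun i => by
      rw [hR, real_inner_comm, (hwK i).2.1, neg_zero]
    have s3 : ∀ i, inner ℝ w (J (v i)) = 0 := fun i => by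
      rw [hJ, real_inner_comm, (hwK i).2.2.1, neg_zero]
    have s4 : ∀ i, inner ℝ w (J (R (v i))) = 0 := fun i => by
      rw [hJ, hR, hRJ, real_inner_comm, inner_neg_right, (hwK i).2.2.2]; simp
    refine ⟨Fin.cons w v, Fin.cons (-d) c, ?_, ?_, ?_, ?_, ?_⟩
    · intro i j
      refine Fin.cases ?_ (fun i => ?_) i <;> refine Fin.cases ?_ (fun j => ?_) j
      · simpa using hw1
      · simp [s1, (Fin.succ_ne_zero _).symm]
      · simp [(hwK _).1]
      · simp [h1]
    · intro i j
      refine Fin.cases ?_ (fun i => ?_) i <;> refine Fin.cases ?_ (fun j => ?_) j <;>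
        simp [e1, s2, h2, (hwK _).2.1]
    · intro i j
      refine Fin.cases ?_ (fun i => ?_) i <;> refine Fin.cases ?_ (fun j => ?_) j <;>
        simp [e2, s3, h3, (hwK _).2.2.1]
    · intro i j
      refine Fin.cases ?_ (fun i => ?_) i <;> refine Fin.cases ?_ (fun j => ?_) j <;>
        simp [e3, s4, h4, (hwK _).2.2.2]
    · intro i
      refine Fin.cases ?_ (fun i => ?_) i
      · simpa using hMw
      · simpa using h5 i

theorem aux_S (n : ℕ) : SSm n = JJ n * RRm n := by
  rw [SSm, JJ, RRm, ← Matrix.mul_kronecker_mul, one_mul]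
  congr 1
  ext a b
  fin_cases a <;> fin_cases b <;> simp [Jb, Rb, Sb, Matrix.mul_apply, Fin.sum_univ_four]

theorem aux_JJ (n : ℕ) : JJ n * JJ n = -1 := by
  have : Jb * Jb = (-1 : ℝ) • 1 := by
    ext a b
    fin_cases a <;> fin_cases b <;> simp [Jb, Matrix.mul_apply, Fin.sum_univ_four]
  rw [JJ, ← Matrix.mul_kronecker_mul, this, Matrix.smul_kronecker, one_mul, Matrix.one_kronecker_one]
  simp

theorem aux_RR (n : ℕ) : RRm n * RRm n = -1 := by
  have : Rb * Rb = (-1 : ℝ) • 1 := by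
    ext a b
    fin_cases a <;> fin_cases b <;> simp [Rb, Matrix.mul_apply, Fin.sum_univ_four]
  rw [RRm, ← Matrix.mul_kronecker_mul, this, Matrix.smul_kronecker, one_mul,
    Matrix.one_kronecker_one]
  simp

theorem aux_RJ (n : ℕ) : RRm n * JJ n = -(JJ n * RRm n) := by
  have : Rb * Jb = (-1 : ℝ) • (Jb * Rb) := by
    ext a b
    fin_cases a <;> fin_cases b <;> simp [Jb, Rb, Matrix.mul_apply, Fin.sum_univ_four]
  rw [RRm, JJ, ← Matrix.mul_kronecker_mul, this, Matrix.smul_kronecker, ← Matrix.mul_kronecker_mul]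
  simp

theorem aux_Jt (n : ℕ) : (JJ n)ᵀ = - JJ n := by
  ext ⟨a, i⟩ ⟨b, j⟩
  fin_cases a <;> fin_cases b <;> simp [JJ, Jb, Matrix.kroneckerMap_apply, Matrix.one_apply, eq_comm] <;>
      split_ifs <;> simp

theorem aux_Rt (n : ℕ) : (RRm n)ᵀ = - RRm n := by
  ext ⟨a, i⟩ ⟨b, j⟩
  fin_cases a <;> fin_cases b <;>
    simp [RRm, Rb, Matrix.kroneckerMap_apply, Matrix.one_apply, eq_comm] <;>
      split_ifs <;> simp

theorem aux_comm {n : ℕ} (X M : Matrix (Fin 4 × Fin n) (Fin 4 × Fin n) ℝ) (hX : X * X = -1)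
    (ht : Xᵀ = -X) (h : X * M * Xᵀ = M) : M * X = X * M := by
  rw [ht] at h
  calc M * X = (X * M * (-X)) * X := by rw [h]
    _ = X * M * (-(X * X)) := by simp [Matrix.mul_assoc]
    _ = X * M := by rw [hX]; simp

theorem aux_skew {ι : Type*} [Fintype ι] [DecidableEq ι] (X : Matrix ι ι ℝ) (ht : Xᵀ = -X)
    (x y : EuclideanSpace ℝ ι) :
    inner ℝ x (Matrix.toEuclideanLin X y) = - inner ℝ (Matrix.toEuclideanLin X x) y := by
  have h := LinearMap.adjoint_inner_left (Matrix.toEuclideanLin X) y x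
  rw [← h, ← Matrix.toEuclideanLin_conjTranspose_eq_adjoint, Matrix.conjTranspose_eq_transpose_of_trivial,
    ht, map_neg, LinearMap.neg_apply, inner_neg_left]

theorem aux_mul {ι : Type*} [Fintype ι] [DecidableEq ι] (X Y : Matrix ι ι ℝ)
    (x : EuclideanSpace ℝ ι) :
    Matrix.toEuclideanLin X (Matrix.toEuclideanLin Y x) = Matrix.toEuclideanLin (X * Y) x := by
  simp [Matrix.toLpLin_apply]

theorem aux_entry {ι κ : Type*} [Fintype ι] [DecidableEq ι] (f : κ → EuclideanSpace ℝ ι)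
    (X : Matrix ι ι ℝ) (p q : κ) :
    ((Matrix.of fun p s => f p s) * X * (Matrix.of fun p s => f p s)ᵀ) p q
      = inner ℝ (f p) (Matrix.toEuclideanLin X (f q)) := by
  rw [Matrix.mul_assoc]
  simp [Matrix.mul_apply, PiLp.inner_apply, Matrix.toLpLin_apply, Matrix.mulVec, dotProduct, mul_comm]

/-- A skew-symmetric JRS-symmetric matrix is orthogonally
JRS-symplectically similar to a JRS-Hessenberg form with `H₀` skew-symmetric
tridiagonal and `H₁, H₂, H₃` diagonal. -/
theorem jrs_skew_symmetric_reduction {n : ℕ}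
    (M : Matrix (Fin 4 × Fin n) (Fin 4 × Fin n) ℝ)
    (hM : JRSSymmetric M) (hskew : Mᵀ = -M) :
    ∃ (W : Matrix (Fin 4 × Fin n) (Fin 4 × Fin n) ℝ)
      (H0 H1 H2 H3 : Matrix (Fin n) (Fin n) ℝ),
      OrthoJRSSymplectic W ∧
      W * M * Wᵀ = upsilonBlocks H0 H1 H2 H3 ∧
      H0ᵀ = -H0 ∧ TridiagonalM H0 ∧
      (∀ i j : Fin n, i ≠ j → H1 i j = 0) ∧
      (∀ i j : Fin n, i ≠ j → H2 i j = 0) ∧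
      (∀ i j : Fin n, i ≠ j → H3 i j = 0) := by
  obtain ⟨hMJ0, hMR0, -⟩ := hM
  have hMJ := aux_comm _ _ (aux_JJ n) (aux_Jt n) hMJ0
  have hMR := aux_comm _ _ (aux_RR n) (aux_Rt n) hMR0
  have kJ := aux_skew _ (aux_Jt n)
  have kR := aux_skew _ (aux_Rt n)
  have kM := aux_skew _ hskew
  have kJJ : ∀ x, Matrix.toEuclideanLin (JJ n) (Matrix.toEuclideanLin (JJ n) x) = -x := by
    intro x; rw [aux_mul, aux_JJ]; simp [Matrix.toLpLin_apply]
  have kRR : ∀ x, Matrix.toEuclideanLin (RRm n) (Matrix.toEuclideanLin (RRm n) x) = -x := by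
    intro x; rw [aux_mul, aux_RR]; simp [Matrix.toLpLin_apply]
  have kRJ : ∀ x, Matrix.toEuclideanLin (RRm n) (Matrix.toEuclideanLin (JJ n) x)
      = - Matrix.toEuclideanLin (JJ n) (Matrix.toEuclideanLin (RRm n) x) := by
    intro x; rw [aux_mul, aux_RJ, aux_mul, map_neg, LinearMap.neg_apply]
  have kMJ : ∀ x, Matrix.toEuclideanLin M (Matrix.toEuclideanLin (JJ n) x)
      = Matrix.toEuclideanLin (JJ n) (Matrix.toEuclideanLin M x) := by
    intro x; rw [aux_mul, hMJ, aux_mul]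
  have kMR : ∀ x, Matrix.toEuclideanLin M (Matrix.toEuclideanLin (RRm n) x)
      = Matrix.toEuclideanLin (RRm n) (Matrix.toEuclideanLin M x) := by
    intro x; rw [aux_mul, hMR, aux_mul]
  obtain ⟨v, c, h1, h2, h3, h4, h5⟩ := aux_family (Matrix.toEuclideanLin (JJ n))
    (Matrix.toEuclideanLin (RRm n)) (Matrix.toEuclideanLin M) kJ kR kM kJJ kRR kRJ kMJ kMR n
    (by simp)
  have eJ : ∀ a b i j, Jb a b * (1 : Matrix (Fin n) (Fin n) ℝ) i j = JJ n (a, i) (b, j) :=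
    fun _ _ _ _ => rfl
  have eR : ∀ a b i j, Rb a b * (1 : Matrix (Fin n) (Fin n) ℝ) i j = RRm n (a, i) (b, j) :=
    fun _ _ _ _ => rfl
  generalize hj : Matrix.toEuclideanLin (JJ n) = J at *
  generalize hr : Matrix.toEuclideanLin (RRm n) = R at *
  generalize hm : Matrix.toEuclideanLin M = N at *
  have kJ' : ∀ x y, inner ℝ (J x) y = - inner ℝ x (J y) := fun x y => by rw [kJ, neg_neg]
  have kR' : ∀ x y, inner ℝ (R x) y = - inner ℝ x (R y) := fun x y => by rw [kR, neg_neg]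
  let f : Fin 4 × Fin n → EuclideanSpace ℝ (Fin 4 × Fin n) := fun p =>
    (![v p.2, R (v p.2), J (v p.2), J (R (v p.2))] : Fin 4 → EuclideanSpace ℝ (Fin 4 × Fin n)) p.1
  let W : Matrix (Fin 4 × Fin n) (Fin 4 × Fin n) ℝ := Matrix.of fun p s => f p s
  have hWW : W * Wᵀ = 1 := by
    have : W * Wᵀ = W * 1 * Wᵀ := by rw [Matrix.mul_one]
    rw [this]
    ext ⟨a, i⟩ ⟨b, j⟩
    rw [aux_entry, Matrix.toLpLin_one, LinearMap.id_apply]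
    fin_cases a <;> fin_cases b <;>
      simp [f, kJ', kR', kJJ, kRR, kRJ, h1, h2, h3, h4, Matrix.one_apply]
  have hWW' : Wᵀ * W = 1 := mul_eq_one_comm.mp hWW
  have hWJ : W * JJ n * Wᵀ = JJ n := by
    ext ⟨a, i⟩ ⟨b, j⟩
    rw [aux_entry, hj, ← eJ]
    fin_cases a <;> fin_cases b <;>
      simp [f, Jb, kJ', kR', kJJ, kRR, kRJ, h1, h2, h3, h4, Matrix.one_apply] <;>
      split_ifs <;> simp
  have hWR : W * RRm n * Wᵀ = RRm n := by
    ext ⟨a, i⟩ ⟨b, j⟩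
    rw [aux_entry, hr, ← eR]
    fin_cases a <;> fin_cases b <;>
      simp [f, Rb, kJ', kR', kJJ, kRR, kRJ, h1, h2, h3, h4, Matrix.one_apply] <;>
      split_ifs <;> simp
  have hWS : W * SSm n * Wᵀ = SSm n := by
    rw [aux_S]
    calc W * (JJ n * RRm n) * Wᵀ = W * JJ n * 1 * (RRm n * Wᵀ) := by
          simp only [Matrix.mul_assoc, Matrix.mul_one]
      _ = (W * JJ n * Wᵀ) * (W * RRm n * Wᵀ) := by
          rw [← hWW']; simp only [Matrix.mul_assoc]
      _ = _ := by rw [hWJ, hWR]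
  refine ⟨W, 0, Matrix.diagonal fun i => -c i, 0, 0, ⟨hWW', hWJ, hWR, hWS⟩, ?_, by simp,
    fun _ _ _ => rfl, fun i j hij => Matrix.diagonal_apply_ne _ hij, fun _ _ _ => rfl,
    fun _ _ _ => rfl⟩
  ext ⟨a, i⟩ ⟨b, j⟩
  rw [aux_entry, hm]
  have hd : (Matrix.diagonal fun i => -c i : Matrix (Fin n) (Fin n) ℝ) i j
      = if i = j then -c j else 0 := by
    rw [Matrix.diagonal_apply]; split_ifs with h
    · rw [h]
    · rfl
  simp only [upsilonBlocks, hd]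
  fin_cases a <;> fin_cases b <;>
    simp [f, kMJ, kMR, h5, inner_smul_right, kJ', kR', kJJ, kRR, kRJ, h1, h2, h3, h4] <;>
      split_ifs <;> simp
end
end
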